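/- Fix c₀ > 0, 0 < s' < 1/2 and T > 0. There exists C > 0, independent of δ, such that for all 0 < δ < 1, 0 ≤ t ≤ T, ξ ∈ ℝ and θ ∈ [−π/2, π/2]: |(∂_ξ G_δ)(t,ξ) − (∂_ξ G_δ)(t, ξ cos θ)| ≤ C sin²(θ/2) ⟨ξ⟩^{(4s'−1)⁺} G_δ(t, ξ cos θ) G_δ(t, ξ sin θ), where (4s'−1)⁺ = max{4s'−1, 0}. -/

import Mathlib

open MeasureTheory Real

noncomputable section

/-- Japanese bracket `⟨ξ⟩ = (1+ξ²)^{1/2}`. -/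
def jap (v : ℝ) : ℝ := Real.sqrt (1 + v ^ 2)

/-- The exponential mollifier
`G_δ(t,ξ) = e^{c₀ t ⟨ξ⟩^{2s'}} / (1 + δ e^{c₀ t ⟨ξ⟩^{2s'}})`. -/
def Gmol (c₀ s' δ t ξ : ℝ) : ℝ :=
  Real.exp (c₀ * t * jap ξ ^ (2 * s')) / (1 + δ * Real.exp (c₀ * t * jap ξ ^ (2 * s')))

theorem one_le_jap (x : ℝ) : 1 ≤ jap x := by
  rw [jap, Real.one_le_sqrt]
  nlinarith [sq_nonneg x]

theorem jap_rpow_two_mul (x r : ℝ) : jap x ^ (2 * r) = (1 + x ^ 2) ^ r := by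
  have h : (0 : ℝ) ≤ 1 + x ^ 2 := by positivity
  rw [Real.rpow_mul (zero_le_one.trans (one_le_jap x)), jap, Real.rpow_two, Real.sq_sqrt h]

theorem abs_le_jap (x : ℝ) : |x| ≤ jap x := by
  rw [jap]
  exact Real.abs_le_sqrt (by linarith)

/-- The logistic profile `x ↦ eˣ / (1 + δ eˣ)`, through which `Gmol` factors. -/
def logisticProfile (δ x : ℝ) : ℝ := Real.exp x / (1 + δ * Real.exp x)

section Profile

variable {δ : ℝ}

theorem hasDerivAt_logisticProfile (hδ : 0 < δ) (x : ℝ) :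
    HasDerivAt (logisticProfile δ) (Real.exp x / (1 + δ * Real.exp x) ^ 2) x := by
  have h0 : 1 + δ * Real.exp x ≠ 0 := by positivity
  have h := (Real.hasDerivAt_exp x).div
    (((Real.hasDerivAt_exp x).const_mul δ).const_add 1) h0
  refine h.congr_deriv ?_
  field_simp
  ring

theorem hasDerivAt_exp_div_sq (hδ : 0 < δ) (x : ℝ) :
    HasDerivAt (fun y => Real.exp y / (1 + δ * Real.exp y) ^ 2)
      (Real.exp x * (1 - δ * Real.exp x) / (1 + δ * Real.exp x) ^ 3) x := by
  have h0 : 1 + δ * Real.exp x ≠ 0 := by positivity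
  have h := (Real.hasDerivAt_exp x).div
    ((((Real.hasDerivAt_exp x).const_mul δ).const_add 1).pow 2) (pow_ne_zero 2 h0)
  refine h.congr_deriv ?_
  simp only [Pi.pow_apply]
  field_simp
  ring

theorem logisticProfile_pos (hδ : 0 < δ) (x : ℝ) : 0 < logisticProfile δ x := by
  unfold logisticProfile
  positivity

theorem logisticProfile_mono (hδ : 0 < δ) : Monotone (logisticProfile δ) := by
  intro x y hxy
  have h := Real.exp_le_exp.2 hxy
  unfold logisticProfile
  rw [div_le_div_iff₀ (by positivity) (by positivity)]
  nlinarith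

theorem exp_div_sq_le_logisticProfile (hδ : 0 < δ) (x : ℝ) :
    Real.exp x / (1 + δ * Real.exp x) ^ 2 ≤ logisticProfile δ x := by
  unfold logisticProfile
  have h : 0 < δ * Real.exp x := by positivity
  gcongr
  nlinarith

theorem abs_deriv_exp_div_sq_le_logisticProfile (hδ : 0 < δ) (x : ℝ) :
    |Real.exp x * (1 - δ * Real.exp x) / (1 + δ * Real.exp x) ^ 3| ≤ logisticProfile δ x := by
  unfold logisticProfile
  have h : 0 < δ * Real.exp x := by positivity
  have h1 : |1 - δ * Real.exp x| ≤ (1 + δ * Real.exp x) ^ 2 := by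
    rw [abs_le]
    constructor <;> nlinarith
  rw [abs_div, abs_mul, abs_of_pos (Real.exp_pos x),
    abs_of_pos (show 0 < (1 + δ * Real.exp x) ^ 3 by positivity),
    div_le_div_iff₀ (by positivity) (by positivity)]
  calc Real.exp x * |1 - δ * Real.exp x| * (1 + δ * Real.exp x)
      ≤ Real.exp x * (1 + δ * Real.exp x) ^ 2 * (1 + δ * Real.exp x) := by gcongr
    _ = Real.exp x * (1 + δ * Real.exp x) ^ 3 := by ring

theorem half_le_logisticProfile (hδ : 0 < δ) (hδ1 : δ < 1) {x : ℝ} (hx : 0 ≤ x) :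
    1 / 2 ≤ logisticProfile δ x := by
  have h := Real.one_le_exp hx
  unfold logisticProfile
  rw [div_le_div_iff₀ (by positivity) (by positivity)]
  nlinarith

theorem logisticProfile_add_le (hδ : 0 < δ) (hδ1 : δ < 1) {x y : ℝ} (hx : 0 ≤ x) (hy : 0 ≤ y) :
    logisticProfile δ (x + y) ≤ 3 * (logisticProfile δ x * logisticProfile δ y) := by
  have h1 := Real.one_le_exp hx
  have h2 := Real.one_le_exp hy
  unfold logisticProfile
  rw [Real.exp_add, div_mul_div_comm, mul_div_assoc', div_le_div_iff₀ (by positivity) (by positivity)]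
  generalize Real.exp x = A at *
  generalize Real.exp y = B at *
  have hA : A ≤ A * B := by nlinarith
  have hB : B ≤ A * B := by nlinarith
  have hAB : 0 < A * B := by positivity
  have h3 : (1 + δ * A) * (1 + δ * B) ≤ 3 * (1 + δ * (A * B)) := by
    have e1 : δ * A ≤ δ * (A * B) := by gcongr
    have e2 : δ * B ≤ δ * (A * B) := by gcongr
    have e3 : δ * (δ * (A * B)) ≤ 1 * (δ * (A * B)) := by gcongr
    nlinarith
  calc A * B * ((1 + δ * A) * (1 + δ * B)) ≤ A * B * (3 * (1 + δ * (A * B))) := by gcongr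
    _ = 3 * (A * B) * (1 + δ * (A * B)) := by ring

end Profile

theorem Gmol_eq_logisticProfile (c₀ s δ t x : ℝ) :
    Gmol c₀ s δ t x = logisticProfile δ (c₀ * t * (1 + x ^ 2) ^ s) := by
  rw [Gmol, jap_rpow_two_mul, logisticProfile]

theorem hasDerivAt_one_add_sq_rpow (r x : ℝ) :
    HasDerivAt (fun y : ℝ => (1 + y ^ 2) ^ r) (2 * r * x * (1 + x ^ 2) ^ (r - 1)) x := by
  have h0 : (1 + x ^ 2 : ℝ) ≠ 0 := by positivity
  have h := ((hasDerivAt_pow 2 x).const_add 1).rpow_const (p := r) (Or.inl h0)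
  refine h.congr_deriv ?_
  push_cast
  ring

theorem one_add_sq_rpow_le_add {s : ℝ} (hs : 0 ≤ s) (hs1 : s ≤ 1) {x y z : ℝ}
    (h : x ^ 2 = y ^ 2 + z ^ 2) :
    (1 + x ^ 2) ^ s ≤ (1 + y ^ 2) ^ s + (1 + z ^ 2) ^ s :=
  calc (1 + x ^ 2) ^ s ≤ ((1 + y ^ 2) + (1 + z ^ 2)) ^ s := by
        exact Real.rpow_le_rpow (by positivity) (by linarith) hs
    _ ≤ _ := Real.rpow_add_le_add_rpow (by positivity) (by positivity) hs hs1

section Derivatives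

variable {b s δ : ℝ}

theorem hasDerivAt_logisticProfile_comp (hδ : 0 < δ) (x : ℝ) :
    HasDerivAt (fun y => logisticProfile δ (b * (1 + y ^ 2) ^ s))
      (Real.exp (b * (1 + x ^ 2) ^ s) / (1 + δ * Real.exp (b * (1 + x ^ 2) ^ s)) ^ 2
        * (b * (2 * s * x * (1 + x ^ 2) ^ (s - 1)))) x :=
  (hasDerivAt_logisticProfile hδ _).comp x ((hasDerivAt_one_add_sq_rpow s x).const_mul b)

theorem abs_phase_deriv_le (hb : 0 ≤ b) (hs : 0 < s) (hs' : s < 1 / 2) (x : ℝ) :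
    |b * (2 * s * x * (1 + x ^ 2) ^ (s - 1))| ≤ b * (1 + x ^ 2) ^ (s - 1 / 2) := by
  have hu : (0 : ℝ) < 1 + x ^ 2 := by positivity
  have hx : |x| ≤ (1 + x ^ 2) ^ (1 / 2 : ℝ) := by
    rw [← Real.sqrt_eq_rpow]
    exact Real.abs_le_sqrt (by linarith)
  rw [abs_mul, abs_mul, abs_mul, abs_of_nonneg hb, abs_of_pos (show 0 < 2 * s by linarith),
    abs_of_pos (Real.rpow_pos_of_pos hu _)]
  calc b * (2 * s * |x| * (1 + x ^ 2) ^ (s - 1))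
      ≤ b * (1 * (1 + x ^ 2) ^ (1 / 2 : ℝ) * (1 + x ^ 2) ^ (s - 1)) := by
        gcongr
        linarith
    _ = b * (1 + x ^ 2) ^ (s - 1 / 2) := by
        rw [one_mul, ← Real.rpow_add hu]
        ring_nf

theorem abs_deriv_logisticProfile_comp_le (hδ : 0 < δ) (hb : 0 ≤ b) (hs : 0 < s) (hs' : s < 1 / 2)
    (x : ℝ) :
    |deriv (fun y => logisticProfile δ (b * (1 + y ^ 2) ^ s)) x|
      ≤ b * logisticProfile δ (b * (1 + x ^ 2) ^ s) := by
  rw [(hasDerivAt_logisticProfile_comp hδ x).deriv, abs_mul, mul_comm b (logisticProfile _ _),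
    abs_of_pos (by positivity)]
  have h1 : (1 + x ^ 2) ^ (s - 1 / 2) ≤ 1 :=
    Real.rpow_le_one_of_one_le_of_nonpos (by nlinarith [sq_nonneg x]) (by linarith)
  have h2 : |b * (2 * s * x * (1 + x ^ 2) ^ (s - 1))| ≤ b :=
    (abs_phase_deriv_le hb hs hs' x).trans (mul_le_of_le_one_right hb h1)
  exact mul_le_mul (exp_div_sq_le_logisticProfile hδ _) h2 (abs_nonneg _)
    (logisticProfile_pos hδ _).le

theorem exists_hasDerivAt_deriv_logisticProfile_comp (hδ : 0 < δ) (hb : 0 ≤ b) (hs : 0 < s)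
    (hs' : s < 1 / 2) (x : ℝ) :
    ∃ d, HasDerivAt (deriv fun y => logisticProfile δ (b * (1 + y ^ 2) ^ s)) d x ∧
      |d| ≤ (3 * b + b ^ 2) * (1 + x ^ 2) ^ (2 * s - 1)
        * logisticProfile δ (b * (1 + x ^ 2) ^ s) := by
  have hu : (0 : ℝ) < 1 + x ^ 2 := by positivity
  have hu1 : (1 : ℝ) ≤ 1 + x ^ 2 := by nlinarith [sq_nonneg x]
  rw [show (deriv fun y => logisticProfile δ (b * (1 + y ^ 2) ^ s)) = _ from
    funext fun y => (hasDerivAt_logisticProfile_comp hδ y).deriv]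
  have hphase := (hasDerivAt_one_add_sq_rpow s x).const_mul b
  have hphase' := ((((hasDerivAt_id x).const_mul (2 * s))).mul
    (hasDerivAt_one_add_sq_rpow (s - 1) x)).const_mul b
  refine ⟨_, ((hasDerivAt_exp_div_sq hδ _).comp x hphase).mul hphase', ?_⟩
  have hd1 := abs_phase_deriv_le hb hs hs' x
  have hd2 : |b * (2 * s * 1 * (1 + x ^ 2) ^ (s - 1)
      + 2 * s * x * (2 * (s - 1) * x * (1 + x ^ 2) ^ (s - 1 - 1)))|
      ≤ 3 * b * (1 + x ^ 2) ^ (2 * s - 1) := by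
    have e : (1 + x ^ 2) ^ (s - 1) = (1 + x ^ 2) * (1 + x ^ 2) ^ (s - 1 - 1) := by
      rw [← Real.rpow_one_add' hu.le (by linarith)]
      ring_nf
    have hle : (1 + x ^ 2) ^ (s - 1) ≤ (1 + x ^ 2) ^ (2 * s - 1) :=
      Real.rpow_le_rpow_of_exponent_le hu1 (by linarith)
    have hp := Real.rpow_pos_of_pos hu (s - 1 - 1)
    have hP : 0 ≤ x ^ 2 * (1 + x ^ 2) ^ (s - 1 - 1) := by positivity
    have hQ : x ^ 2 * (1 + x ^ 2) ^ (s - 1 - 1) ≤ (1 + x ^ 2) ^ (s - 1) := by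
      rw [e]
      nlinarith
    rw [abs_mul, abs_of_nonneg hb, mul_comm 3 b, mul_assoc b 3]
    refine mul_le_mul_of_nonneg_left ?_ hb
    generalize (1 + x ^ 2) ^ (s - 1) = P at *
    rw [show 2 * s * x * (2 * (s - 1) * x * (1 + x ^ 2) ^ (s - 1 - 1))
      = -(4 * s * (1 - s) * (x ^ 2 * (1 + x ^ 2) ^ (s - 1 - 1))) by ring]
    generalize x ^ 2 * (1 + x ^ 2) ^ (s - 1 - 1) = Q at *
    have h4 : 4 * s * (1 - s) ≤ 1 := by nlinarith [sq_nonneg (2 * s - 1)]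
    have h40 : 0 ≤ 4 * s * (1 - s) := by nlinarith
    have hs2 : 2 * s * P ≤ 1 * P := mul_le_mul_of_nonneg_right (by linarith) (hP.trans hQ)
    have hs3 : 0 ≤ 2 * s * P := mul_nonneg (by linarith) (hP.trans hQ)
    have hs4 : 4 * s * (1 - s) * Q ≤ 1 * Q := mul_le_mul_of_nonneg_right h4 hP
    have hs5 := mul_nonneg h40 hP
    rw [abs_le]
    constructor <;> linarith
  have hsq : ((1 + x ^ 2) ^ (s - 1 / 2)) ^ 2 = (1 + x ^ 2) ^ (2 * s - 1) := by
    rw [← Real.rpow_natCast, ← Real.rpow_mul hu.le]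
    congr 1
    push_cast
    ring
  have hg := logisticProfile_pos hδ (b * (1 + x ^ 2) ^ s)
  have hg1 := exp_div_sq_le_logisticProfile hδ (b * (1 + x ^ 2) ^ s)
  have hg2 := abs_deriv_exp_div_sq_le_logisticProfile hδ (b * (1 + x ^ 2) ^ s)
  have hg0 : 0 ≤ Real.exp (b * (1 + x ^ 2) ^ s)
    / (1 + δ * Real.exp (b * (1 + x ^ 2) ^ s)) ^ 2 := by positivity
  simp only [Function.comp_apply, id]
  generalize logisticProfile δ (b * (1 + x ^ 2) ^ s) = g at *
  refine (abs_add_le _ _).trans ?_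
  rw [abs_mul, abs_mul (_ * _ / _), abs_mul (_ / _), abs_of_nonneg hg0]
  calc _ ≤ g * (b * (1 + x ^ 2) ^ (s - 1 / 2)) * (b * (1 + x ^ 2) ^ (s - 1 / 2))
        + g * (3 * b * (1 + x ^ 2) ^ (2 * s - 1)) := by
        gcongr
    _ = _ := by
        rw [← hsq]
        ring

/-- The bound obtained from the mean value theorem on the segment between `c * x` and `x`. -/
theorem abs_deriv_logisticProfile_comp_sub_le (hδ : 0 < δ) (hb : 0 ≤ b) (hs : 0 < s)
    (hs' : s < 1 / 2) (x : ℝ) {c : ℝ} (hc : 1 / 2 ≤ c) (hc1 : c ≤ 1) :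
    |deriv (fun y => logisticProfile δ (b * (1 + y ^ 2) ^ s)) x
        - deriv (fun y => logisticProfile δ (b * (1 + y ^ 2) ^ s)) (x * c)|
      ≤ 4 * (3 * b + b ^ 2) * (1 + x ^ 2) ^ (2 * s - 1)
        * logisticProfile δ (b * (1 + x ^ 2) ^ s) * (|x| * (1 - c)) := by
  choose d hd hdle using
    exists_hasDerivAt_deriv_logisticProfile_comp (δ := δ) (b := b) (s := s) hδ hb hs hs'
  have hu : (0 : ℝ) < 1 + x ^ 2 := by positivity
  have key : ∀ y ∈ segment ℝ (x * c) x, ‖d y‖ ≤ 4 * (3 * b + b ^ 2) * (1 + x ^ 2) ^ (2 * s - 1)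
      * logisticProfile δ (b * (1 + x ^ 2) ^ s) := by
    rintro y ⟨p, q, hp, hq, hpq, rfl⟩
    set r := p * c + q with hr
    have hy : p • (x * c) + q • x = x * r := by
      simp only [smul_eq_mul, hr]
      ring
    have hr1 : r ≤ 1 := by nlinarith
    have hr2 : 1 / 2 ≤ r := by nlinarith
    rw [hy]
    have hlow : (1 + x ^ 2) / 4 ≤ 1 + (x * r) ^ 2 := by
      have : 1 / 4 ≤ r ^ 2 := by nlinarith
      nlinarith [sq_nonneg x, mul_le_mul_of_nonneg_left this (sq_nonneg x)]
    have hup : 1 + (x * r) ^ 2 ≤ 1 + x ^ 2 := by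
      have : r ^ 2 ≤ 1 := by nlinarith
      nlinarith [mul_le_mul_of_nonneg_left this (sq_nonneg x)]
    have h1 : (1 + (x * r) ^ 2) ^ (2 * s - 1) ≤ 4 * (1 + x ^ 2) ^ (2 * s - 1) :=
      calc (1 + (x * r) ^ 2) ^ (2 * s - 1) ≤ ((1 + x ^ 2) / 4) ^ (2 * s - 1) :=
            Real.rpow_le_rpow_of_nonpos (by positivity) hlow (by linarith)
        _ = (1 + x ^ 2) ^ (2 * s - 1) * 4 ^ (1 - 2 * s) := by
            rw [Real.div_rpow hu.le (by norm_num), div_eq_mul_inv,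
              ← Real.rpow_neg (by norm_num)]
            ring_nf
        _ ≤ (1 + x ^ 2) ^ (2 * s - 1) * 4 ^ (1 : ℝ) := by
            gcongr
            · norm_num
            · linarith
        _ = 4 * (1 + x ^ 2) ^ (2 * s - 1) := by
            rw [Real.rpow_one]
            ring
    have h2 : logisticProfile δ (b * (1 + (x * r) ^ 2) ^ s)
        ≤ logisticProfile δ (b * (1 + x ^ 2) ^ s) := by
      apply logisticProfile_mono hδ
      gcongr
    calc ‖d (x * r)‖ ≤ (3 * b + b ^ 2) * (1 + (x * r) ^ 2) ^ (2 * s - 1)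
          * logisticProfile δ (b * (1 + (x * r) ^ 2) ^ s) := hdle _
      _ ≤ (3 * b + b ^ 2) * (4 * (1 + x ^ 2) ^ (2 * s - 1))
          * logisticProfile δ (b * (1 + x ^ 2) ^ s) := by
          have := logisticProfile_pos hδ (b * (1 + (x * r) ^ 2) ^ s)
          gcongr
      _ = _ := by ring
  have h := (convex_segment (x * c) x).norm_image_sub_le_of_norm_hasDerivWithin_le
    (fun y _ => (hd y).hasDerivWithinAt) key (left_mem_segment ℝ _ _) (right_mem_segment ℝ _ _)
  have hx : ‖x - x * c‖ = |x| * (1 - c) := by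
    rw [show x - x * c = x * (1 - c) by ring, Real.norm_eq_abs, abs_mul,
      abs_of_nonneg (show 0 ≤ 1 - c by linarith)]
  rwa [hx, Real.norm_eq_abs] at h

end Derivatives

theorem abs_mul_one_add_sq_rpow_le (s x : ℝ) :
    |x| * (1 + x ^ 2) ^ (2 * s - 1) ≤ jap x ^ (max (4 * s - 1) 0) := by
  have hj := one_le_jap x
  have hj0 : 0 < jap x := zero_lt_one.trans_le hj
  rw [← jap_rpow_two_mul]
  calc |x| * jap x ^ (2 * (2 * s - 1)) ≤ jap x ^ (1 : ℝ) * jap x ^ (2 * (2 * s - 1)) := by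
        rw [Real.rpow_one]
        gcongr
        exact abs_le_jap x
    _ = jap x ^ (4 * s - 1) := by
        rw [← Real.rpow_add hj0]
        ring_nf
    _ ≤ _ := Real.rpow_le_rpow_of_exponent_le hj (le_max_left _ _)

/-- Difference estimate for the `ξ`-derivative of the exponential mollifier:
`|(∂_ξG_δ)(t,ξ) − (∂_ξG_δ)(t,ξcosθ)| ≤ C sin²(θ/2) ⟨ξ⟩^{(4s'−1)⁺} G_δ(t,ξcosθ) G_δ(t,ξsinθ)`,
uniformly in `δ ∈ (0,1)`, `t ∈ [0,T]`, `ξ ∈ ℝ`, `θ ∈ [−π/2,π/2]`. -/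
theorem Gmol_deriv_difference_bound (c₀ s' T : ℝ) (hc₀ : 0 < c₀) (hs'0 : 0 < s')
    (hs' : s' < 1 / 2) (hT : 0 < T) :
    ∃ C : ℝ, 0 < C ∧ ∀ δ : ℝ, 0 < δ → δ < 1 → ∀ t : ℝ, 0 ≤ t → t ≤ T → ∀ ξ : ℝ,
      ∀ θ ∈ Set.Icc (-(Real.pi / 2)) (Real.pi / 2),
        |deriv (fun ζ : ℝ => Gmol c₀ s' δ t ζ) ξ
            - deriv (fun ζ : ℝ => Gmol c₀ s' δ t ζ) (ξ * Real.cos θ)|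
          ≤ C * Real.sin (θ / 2) ^ 2 * jap ξ ^ (max (4 * s' - 1) 0)
            * Gmol c₀ s' δ t (ξ * Real.cos θ) * Gmol c₀ s' δ t (ξ * Real.sin θ) := by
  set K := c₀ * T with hK
  have hK0 : 0 < K := mul_pos hc₀ hT
  refine ⟨24 * (3 * K + K ^ 2), by positivity, ?_⟩
  intro δ hδ hδ1 t ht htT ξ θ hθ
  simp only [Gmol_eq_logisticProfile]
  have hb : 0 ≤ c₀ * t := by positivity
  have hbK : c₀ * t ≤ K := by
    rw [hK]
    gcongr
  generalize c₀ * t = b at *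
  have hc0 : 0 ≤ Real.cos θ := Real.cos_nonneg_of_mem_Icc hθ
  have hcos1 := Real.cos_le_one θ
  have hhalf : Real.sin (θ / 2) ^ 2 = (1 - Real.cos θ) / 2 := by
    rw [Real.sin_sq_eq_half_sub, mul_div_cancel₀ θ two_ne_zero]
    ring
  have hgξ : logisticProfile δ (b * (1 + ξ ^ 2) ^ s')
      ≤ 3 * (logisticProfile δ (b * (1 + (ξ * Real.cos θ) ^ 2) ^ s')
        * logisticProfile δ (b * (1 + (ξ * Real.sin θ) ^ 2) ^ s')) := by
    refine le_trans (logisticProfile_mono hδ ?_)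
      (logisticProfile_add_le hδ hδ1 (by positivity) (by positivity))
    rw [← mul_add]
    refine mul_le_mul_of_nonneg_left (one_add_sq_rpow_le_add hs'0.le (by linarith) ?_) hb
    linear_combination (-ξ ^ 2) * Real.sin_sq_add_cos_sq θ
  have hgs := half_le_logisticProfile hδ hδ1
    (show 0 ≤ b * (1 + (ξ * Real.sin θ) ^ 2) ^ s' by positivity)
  have hgc0 := logisticProfile_pos hδ (b * (1 + (ξ * Real.cos θ) ^ 2) ^ s')
  rw [hhalf]
  rcases le_total (1 / 2) (Real.cos θ) with hc | hc
  · refine (abs_deriv_logisticProfile_comp_sub_le hδ hb hs'0 hs' ξ hc hcos1).trans ?_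
    have hJ := abs_mul_one_add_sq_rpow_le s' ξ
    have h1c : 0 ≤ 1 - Real.cos θ := by linarith
    have hJ0 : 0 ≤ jap ξ ^ (max (4 * s' - 1) 0) := le_trans (by positivity) hJ
    calc _ = 4 * (3 * b + b ^ 2) * (1 - Real.cos θ) * (|ξ| * (1 + ξ ^ 2) ^ (2 * s' - 1))
          * logisticProfile δ (b * (1 + ξ ^ 2) ^ s') := by ring
      _ ≤ 4 * (3 * K + K ^ 2) * (1 - Real.cos θ) * jap ξ ^ (max (4 * s' - 1) 0)
          * (3 * (logisticProfile δ (b * (1 + (ξ * Real.cos θ) ^ 2) ^ s')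
            * logisticProfile δ (b * (1 + (ξ * Real.sin θ) ^ 2) ^ s'))) := by
          have := logisticProfile_pos hδ (b * (1 + ξ ^ 2) ^ s')
          gcongr
      _ = _ := by ring
  · have h1 := abs_deriv_logisticProfile_comp_le hδ hb hs'0 hs' ξ
    have h2 := abs_deriv_logisticProfile_comp_le hδ hb hs'0 hs' (ξ * Real.cos θ)
    have hJ : 1 ≤ jap ξ ^ (max (4 * s' - 1) 0) :=
      Real.one_le_rpow (one_le_jap ξ) (le_max_right _ _)
    refine (abs_sub _ _).trans ?_
    have hD := logisticProfile_pos hδ (b * (1 + ξ ^ 2) ^ s')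
    generalize logisticProfile δ (b * (1 + (ξ * Real.cos θ) ^ 2) ^ s') = A at *
    generalize logisticProfile δ (b * (1 + (ξ * Real.sin θ) ^ 2) ^ s') = B at *
    generalize logisticProfile δ (b * (1 + ξ ^ 2) ^ s') = D at *
    have hA : A ≤ 2 * (A * B) := by nlinarith
    have hAB : 0 < A * B := by nlinarith
    calc _ ≤ b * D + b * A := add_le_add h1 h2
      _ ≤ K * (3 * (A * B)) + K * (2 * (A * B)) := by gcongr
      _ ≤ 6 * (3 * K + K ^ 2) * (A * B) := by
          nlinarith [mul_pos hK0 hAB, mul_pos (pow_pos hK0 2) hAB]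
      _ ≤ 24 * (3 * K + K ^ 2) * ((1 - 1 / 2) / 2) * 1 * (A * B) := by linarith
      _ ≤ 24 * (3 * K + K ^ 2) * ((1 - Real.cos θ) / 2) * jap ξ ^ (max (4 * s' - 1) 0)
          * (A * B) := by
          have h1c : 0 ≤ 1 - Real.cos θ := by linarith
          gcongr
      _ = _ := by ring
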